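/- Let P(x) = x² + p_1 x + p_0 ∈ ℤ[x] with |p_0| ≥ 2, let ε ∈ [0,1), and set k = ⌊ε|p_0|⌋. Suppose either ε ∈ (1/2,1), or ε = 1/2 and |p_0| is even. Then P is an ε-CNS polynomial if and only if either (p_0 ≥ 2 and -|p_0| + k ≤ p_1 ≤ k + 1), or (p_0 ≤ -3, ε < (|p_0|-1)/|p_0|, and -k + 1 ≤ p_1 ≤ -k - 2 + |p_0|). -/

import Mathlib

open Polynomial

/-- `P` is an `ε`-CNS polynomial: every integer polynomial `a` is congruent modulo `P`
to a sum `∑ d_j x^j` whose digits `d_j` lie in `N_ε = [-ε|P(0)|, (1-ε)|P(0)|) ∩ ℤ`. -/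
def IsEpsCNS (ε : ℝ) (P : Polynomial ℤ) : Prop :=
  ∀ a : Polynomial ℤ, ∃ l : ℕ, 0 < l ∧ ∃ dig : ℕ → ℤ,
    (∀ j < l, -(ε * |(P.coeff 0 : ℝ)|) ≤ (dig j : ℝ) ∧
        (dig j : ℝ) < (1 - ε) * |(P.coeff 0 : ℝ)|) ∧
    P ∣ a - ∑ j ∈ Finset.range l, C (dig j) * X ^ j

inductive Good (p0 p1 k m : ℤ) : ℤ → ℤ → Prop
  | zero : Good p0 p1 k m 0 0
  | step (u v w : ℤ) (h1 : 0 ≤ k - u - p1 * v - p0 * w) (h2 : k - u - p1 * v - p0 * w < m)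
      (h : Good p0 p1 k m v w) : Good p0 p1 k m u v

theorem good_not (p0 p1 k m : ℤ) (J : ℤ → ℤ → Prop) (h0 : ¬ J 0 0)
    (hJ : ∀ u v w, J u v → 0 ≤ k - u - p1 * v - p0 * w → k - u - p1 * v - p0 * w < m → J v w)
    (u v : ℤ) (h : Good p0 p1 k m u v) : ¬ J u v := by
  induction h with
  | zero => exact h0
  | step u v w h1 h2 h ih => exact fun hj => ih (hJ u v w hj h1 h2)

theorem good_add (p0 p1 k m : ℤ) (hm : m = |p0|) (hp : 2 ≤ m) (V : ℤ → ℤ → Prop)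
    (hV : ∀ u v w, V u v → -m < p0 * w + u + p1 * v → p0 * w + u + p1 * v < m → V v w)
    (hG : ∀ u v, V u v → Good p0 p1 k m u v)
    (u v : ℤ) (h : Good p0 p1 k m u v) :
    ∀ u' v', V u' v' → Good p0 p1 k m (u + u') (v + v') := by
  have hp0 : p0 ≠ 0 := by
    rintro rfl
    simp at hm
    omega
  induction h with
  | zero => intro u' v' h; simpa using hG u' v' h
  | step u v w h1 h2 h ih =>
    intro u' v' h'
    obtain ⟨w', hw'⟩ : ∃ w', (k - (u + u') - p1 * (v + v')) / p0 = w + w' :=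
      ⟨(k - (u + u') - p1 * (v + v')) / p0 - w, by ring⟩
    have e := Int.emod_add_mul_ediv (k - (u + u') - p1 * (v + v')) p0
    have e1 := Int.emod_nonneg (k - (u + u') - p1 * (v + v')) hp0
    have e2 := Int.emod_lt_abs (k - (u + u') - p1 * (v + v')) hp0
    rw [← hm] at e2
    rw [hw'] at e
    refine Good.step _ _ (w + w') (by linarith) (by linarith) (ih v' w' (hV u' v' w' h' ?_ ?_))
    · linarith
    · linarith

theorem good_all (p0 p1 k m : ℤ) (hm : m = |p0|) (hp : 2 ≤ m) (V : ℤ → ℤ → Prop)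
    (hV : ∀ u v w, V u v → -m < p0 * w + u + p1 * v → p0 * w + u + p1 * v < m → V v w)
    (hG : ∀ u v, V u v → Good p0 p1 k m u v)
    (a1 : V 1 0) (a2 : V (-1) 0) (a3 : V 0 1) (a4 : V 0 (-1)) (u v : ℤ) :
    Good p0 p1 k m u v := by
  have H := good_add p0 p1 k m hm hp V hV hG
  have key : ∀ u : ℤ, Good p0 p1 k m u 0 := by
    intro u
    induction u using Int.induction_on with
    | zero => exact Good.zero
    | succ i ih => simpa using H _ _ ih _ _ a1
    | pred i ih => simpa [sub_eq_add_neg] using H _ _ ih _ _ a2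
  induction v using Int.induction_on with
  | zero => exact key u
  | succ i ih => simpa using H _ _ ih _ _ a3
  | pred i ih => simpa [sub_eq_add_neg] using H _ _ ih _ _ a4

theorem wbound (m c w : ℤ) (hm : 2 ≤ m) (h1 : -m < m * w + c) (h2 : m * w + c < m)
    (hc : -m ≤ c) (hc' : c ≤ m) : w = -1 ∨ w = 0 ∨ w = 1 := by
  have : w < 2 := by by_contra h; push Not at h; nlinarith
  have : -2 < w := by by_contra h; push Not at h; nlinarith
  omega

theorem good_pos (m p1 k : ℤ) (hp : 2 ≤ m) (hk : m - 1 ≤ 2 * k) (hk' : k ≤ m - 1)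
    (h1 : -m + k ≤ p1) (h2 : p1 ≤ k + 1) (u v : ℤ) : Good m p1 k m u v := by
  have hm : m = |m| := (abs_of_nonneg (by omega)).symm
  have z := Good.zero (p0 := m) (p1 := p1) (k := k) (m := m)
  have g10 : Good m p1 k m 1 0 := Good.step 1 0 0 (by omega) (by omega) z
  rcases lt_trichotomy p1 0 with h | h | h
  · have g11 : Good m p1 k m 1 1 := Good.step _ _ 0 (by omega) (by omega) g10
    have g01 : Good m p1 k m 0 1 := by
      by_cases c : k - p1 < m
      · exact Good.step _ _ 0 (by omega) (by omega) g10
      · exact Good.step _ _ 1 (by omega) (by omega) g11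
    have gn0 : Good m p1 k m (-1) 0 := by
      by_cases c : k + 1 < m
      · exact Good.step _ _ 0 (by omega) (by omega) z
      · exact Good.step _ _ 1 (by omega) (by omega) g01
    have gnn : Good m p1 k m (-1) (-1) := Good.step _ _ 0 (by omega) (by omega) gn0
    have g0n : Good m p1 k m 0 (-1) := by
      by_cases c : 0 ≤ k + p1
      · exact Good.step _ _ 0 (by omega) (by omega) gn0
      · exact Good.step _ _ (-1) (by omega) (by omega) gnn
    refine good_all m p1 k m hm hp
      (fun u v => (0 ≤ u ∧ u ≤ 1 ∧ 0 ≤ v ∧ v ≤ 1) ∨ (-1 ≤ u ∧ u ≤ 0 ∧ -1 ≤ v ∧ v ≤ 0))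
      ?_ ?_ (by simp) (by simp) (by simp) (by simp) u v
    · rintro u v w (⟨a, b, c, d⟩ | ⟨a, b, c, d⟩) e f <;> interval_cases u <;> interval_cases v <;>
      rcases wbound m _ w hp (by rw [← add_assoc]; exact e) (by rw [← add_assoc]; exact f)
        (by omega) (by omega) with rfl | rfl | rfl <;> omega
    · rintro u v (⟨a, b, c, d⟩ | ⟨a, b, c, d⟩) <;> interval_cases u <;> interval_cases v <;> assumption
  · subst h
    have g01 : Good m 0 k m 0 1 := Good.step _ _ 0 (by omega) (by omega) g10
    have gn0 : Good m 0 k m (-1) 0 := by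
      by_cases c : k + 1 < m
      · exact Good.step _ _ 0 (by omega) (by omega) z
      · exact Good.step _ _ 1 (by omega) (by omega) g01
    have g0n : Good m 0 k m 0 (-1) := Good.step _ _ 0 (by omega) (by omega) gn0
    refine good_all m 0 k m hm hp
      (fun u v => (u = 0 ∧ -1 ≤ v ∧ v ≤ 1) ∨ (-1 ≤ u ∧ u ≤ 1 ∧ v = 0))
      ?_ ?_ (by simp) (by simp) (by simp) (by simp) u v
    · rintro u v w (⟨rfl, c, d⟩ | ⟨a, b, rfl⟩) e f
      · have := wbound m 0 w hp (by linarith) (by linarith) (by omega) (by omega)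
        rcases this with rfl | rfl | rfl <;> omega
      · have := wbound m u w hp (by linarith) (by linarith) (by omega) (by omega)
        rcases this with rfl | rfl | rfl <;> omega
    · rintro u v (⟨rfl, c, d⟩ | ⟨a, b, rfl⟩)
      · interval_cases v <;> assumption
      · interval_cases u <;> assumption
  · have gn1 : Good m p1 k m (-1) 1 := Good.step _ _ 0 (by omega) (by omega) g10
    have key : (k + 1 < m ∨ p1 ≤ k ∨ m ≤ k - 1 + p1) := by omega
    have A : Good m p1 k m (-1) 0 ∧ Good m p1 k m 1 (-1) := by
      by_cases c : k + 1 < m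
      · have gn0 : Good m p1 k m (-1) 0 := Good.step _ _ 0 (by omega) (by omega) z
        refine ⟨gn0, ?_⟩
        by_cases c : k - 1 + p1 < m
        · exact Good.step _ _ 0 (by omega) (by omega) gn0
        · exact Good.step _ _ 1 (by omega) (by omega) gn1
      · by_cases c' : p1 ≤ k
        · have g01 : Good m p1 k m 0 1 := Good.step _ _ 0 (by omega) (by omega) g10
          have gn0 : Good m p1 k m (-1) 0 := Good.step _ _ 1 (by omega) (by omega) g01
          refine ⟨gn0, ?_⟩
          by_cases c : k - 1 + p1 < m
          · exact Good.step _ _ 0 (by omega) (by omega) gn0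
          · exact Good.step _ _ 1 (by omega) (by omega) gn1
        · have g1n : Good m p1 k m 1 (-1) := Good.step _ _ 1 (by omega) (by omega) gn1
          have g01 : Good m p1 k m 0 1 := Good.step _ _ (-1) (by omega) (by omega) g1n
          exact ⟨Good.step _ _ 1 (by omega) (by omega) g01, g1n⟩
    obtain ⟨gn0, g1n⟩ := A
    have g01 : Good m p1 k m 0 1 := by
      by_cases c : p1 ≤ k
      · exact Good.step _ _ 0 (by omega) (by omega) g10
      · exact Good.step _ _ (-1) (by omega) (by omega) g1n
    have g0n : Good m p1 k m 0 (-1) := by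
      by_cases c : k + p1 < m
      · exact Good.step _ _ 0 (by omega) (by omega) gn0
      · exact Good.step _ _ 1 (by omega) (by omega) gn1
    refine good_all m p1 k m hm hp
      (fun u v => (0 ≤ u ∧ u ≤ 1 ∧ -1 ≤ v ∧ v ≤ 0) ∨ (-1 ≤ u ∧ u ≤ 0 ∧ 0 ≤ v ∧ v ≤ 1))
      ?_ ?_ (by simp) (by simp) (by simp) (by simp) u v
    · rintro u v w (⟨a, b, c, d⟩ | ⟨a, b, c, d⟩) e f <;> interval_cases u <;> interval_cases v <;>
      rcases wbound m _ w hp (by rw [← add_assoc]; exact e) (by rw [← add_assoc]; exact f)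
        (by omega) (by omega) with rfl | rfl | rfl <;> omega
    · rintro u v (⟨a, b, c, d⟩ | ⟨a, b, c, d⟩) <;> interval_cases u <;> interval_cases v <;> assumption

theorem good_neg (m p1 k : ℤ) (hp : 2 ≤ m) (hk : m - 1 ≤ 2 * k) (hk' : k ≤ m - 2)
    (h1 : -k + 1 ≤ p1) (h2 : p1 ≤ -k - 2 + m) (u v : ℤ) : Good (-m) p1 k m u v := by
  have hm : m = |-m| := by rw [abs_neg]; exact (abs_of_nonneg (by omega)).symm
  have z := Good.zero (p0 := -m) (p1 := p1) (k := k) (m := m)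
  have g10 : Good (-m) p1 k m 1 0 := Good.step 1 0 0 (by omega) (by omega) z
  have gn0 : Good (-m) p1 k m (-1) 0 := Good.step _ 0 0 (by omega) (by omega) z
  rcases lt_trichotomy p1 0 with h | h | h
  · have g1n : Good (-m) p1 k m 1 (-1) := Good.step _ _ 0 (by omega) (by omega) gn0
    have g0n : Good (-m) p1 k m 0 (-1) := Good.step _ _ 0 (by omega) (by omega) gn0
    have g01 : Good (-m) p1 k m 0 1 := by
      by_cases c : k - p1 < m
      · exact Good.step _ _ 0 (by omega) (by omega) g10
      · exact Good.step _ _ (-1) (by omega) (by omega) g1n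
    have gn1 : Good (-m) p1 k m (-1) 1 := by
      by_cases c : k + 1 - p1 < m
      · exact Good.step _ _ 0 (by omega) (by omega) g10
      · exact Good.step _ _ (-1) (by omega) (by omega) g1n
    refine good_all (-m) p1 k m hm hp
      (fun u v => (0 ≤ u ∧ u ≤ 1 ∧ -1 ≤ v ∧ v ≤ 0) ∨ (-1 ≤ u ∧ u ≤ 0 ∧ 0 ≤ v ∧ v ≤ 1))
      ?_ ?_ (by simp) (by simp) (by simp) (by simp) u v
    · rintro u v w (⟨a, b, c, d⟩ | ⟨a, b, c, d⟩) e f <;> interval_cases u <;> interval_cases v <;>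
      rcases wbound m _ (-w) hp (by rw [mul_neg, ← neg_mul, ← add_assoc]; exact e)
        (by rw [mul_neg, ← neg_mul, ← add_assoc]; exact f)
        (by omega) (by omega) with hw | hw | hw <;> obtain rfl := neg_eq_iff_eq_neg.mp hw <;> omega
    · rintro u v (⟨a, b, c, d⟩ | ⟨a, b, c, d⟩) <;> interval_cases u <;> interval_cases v <;> assumption
  · subst h
    have g01 : Good (-m) 0 k m 0 1 := Good.step _ _ 0 (by omega) (by omega) g10
    have g0n : Good (-m) 0 k m 0 (-1) := Good.step _ _ 0 (by omega) (by omega) gn0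
    refine good_all (-m) 0 k m hm hp
      (fun u v => (u = 0 ∧ -1 ≤ v ∧ v ≤ 1) ∨ (-1 ≤ u ∧ u ≤ 1 ∧ v = 0))
      ?_ ?_ (by simp) (by simp) (by simp) (by simp) u v
    · rintro u v w (⟨rfl, c, d⟩ | ⟨a, b, rfl⟩) e f
      · have := wbound m 0 (-w) hp (by linarith) (by linarith) (by omega) (by omega)
        rcases this with hw | hw | hw <;> obtain rfl := neg_eq_iff_eq_neg.mp hw <;> omega
      · have := wbound m u (-w) hp (by linarith) (by linarith) (by omega) (by omega)
        rcases this with hw | hw | hw <;> obtain rfl := neg_eq_iff_eq_neg.mp hw <;> omega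
    · rintro u v (⟨rfl, c, d⟩ | ⟨a, b, rfl⟩)
      · interval_cases v <;> assumption
      · interval_cases u <;> assumption
  · have g11 : Good (-m) p1 k m 1 1 := Good.step _ _ 0 (by omega) (by omega) g10
    have g01 : Good (-m) p1 k m 0 1 := Good.step _ _ 0 (by omega) (by omega) g10
    have gnn : Good (-m) p1 k m (-1) (-1) := Good.step _ _ 0 (by omega) (by omega) gn0
    have g0n : Good (-m) p1 k m 0 (-1) := Good.step _ _ 0 (by omega) (by omega) gn0
    refine good_all (-m) p1 k m hm hp
      (fun u v => (0 ≤ u ∧ u ≤ 1 ∧ 0 ≤ v ∧ v ≤ 1) ∨ (-1 ≤ u ∧ u ≤ 0 ∧ -1 ≤ v ∧ v ≤ 0))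
      ?_ ?_ (by simp) (by simp) (by simp) (by simp) u v
    · rintro u v w (⟨a, b, c, d⟩ | ⟨a, b, c, d⟩) e f <;> interval_cases u <;> interval_cases v <;>
      rcases wbound m _ (-w) hp (by rw [mul_neg, ← neg_mul, ← add_assoc]; exact e)
        (by rw [mul_neg, ← neg_mul, ← add_assoc]; exact f)
        (by omega) (by omega) with hw | hw | hw <;> obtain rfl := neg_eq_iff_eq_neg.mp hw <;> omega
    · rintro u v (⟨a, b, c, d⟩ | ⟨a, b, c, d⟩) <;> interval_cases u <;> interval_cases v <;> assumption

/-- uniqueness of the quotient -/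
theorem quot_uniq (m c w w' : ℤ) (hm : 0 < m) (h1 : 0 ≤ c - m * w) (h2 : c - m * w < m)
    (h3 : 0 ≤ c - m * w') (h4 : c - m * w' < m) : w = w' := by
  have a : w < w' + 1 := by by_contra h; push Not at h; nlinarith
  have b : w' < w + 1 := by by_contra h; push Not at h; nlinarith
  omega

/-- constant one is a fixed point -/
theorem bad_one (p0 p1 k m : ℤ) (hm : m = |p0|) (hp : 2 ≤ m)
    (c : ℤ) (hc : c ≠ 0) (h1 : 0 ≤ k - c - p1 * c - p0 * c) (h2 : k - c - p1 * c - p0 * c < m) :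
    ¬ Good p0 p1 k m c c := by
  intro h
  refine good_not p0 p1 k m (fun u v => u = c ∧ v = c) (by rintro ⟨rfl, -⟩; exact hc rfl) ?_ c c h
    ⟨rfl, rfl⟩
  rintro u v w ⟨rfl, rfl⟩ h3 h4
  refine ⟨rfl, ?_⟩
  rcases abs_choice p0 with e | e
  · rw [e] at hm; subst hm
    exact quot_uniq m (k - v - p1 * v) w v (by omega) h3 h4 h1 h2
  · rw [e] at hm
    obtain rfl : p0 = -m := by omega
    have := quot_uniq m (k - v - p1 * v) (-w) (-v) (by omega) (by linarith) (by linarith)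
      (by linarith) (by linarith)
    omega

theorem bad_alt (p0 p1 k m : ℤ) (hm : m = |p0|) (hp : 2 ≤ m)
    (h1 : 0 ≤ k - 1 + p1 - p0) (h2 : k - 1 + p1 - p0 < m)
    (h3 : 0 ≤ k + 1 - p1 + p0) (h4 : k + 1 - p1 + p0 < m) :
    ¬ Good p0 p1 k m 1 (-1) := by
  intro h
  refine good_not p0 p1 k m (fun u v => (u = 1 ∧ v = -1) ∨ (u = -1 ∧ v = 1)) (by simp) ?_ _ _ h
    (by simp)
  rintro u v w (⟨rfl, rfl⟩ | ⟨rfl, rfl⟩) h5 h6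
  · refine Or.inr ⟨rfl, ?_⟩
    rcases abs_choice p0 with e | e
    · rw [e] at hm; subst hm
      exact quot_uniq m (k - 1 + p1) w 1 (by omega) (by linarith) (by linarith)
        (by linarith) (by linarith)
    · rw [e] at hm
      obtain rfl : p0 = -m := by omega
      have := quot_uniq m (k - 1 + p1) (-w) (-1) (by omega) (by linarith) (by linarith)
        (by linarith) (by linarith)
      omega
  · refine Or.inl ⟨rfl, ?_⟩
    rcases abs_choice p0 with e | e
    · rw [e] at hm; subst hm
      exact quot_uniq m (k + 1 - p1) w (-1) (by omega) (by linarith) (by linarith)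
        (by linarith) (by linarith)
    · rw [e] at hm
      obtain rfl : p0 = -m := by omega
      have := quot_uniq m (k + 1 - p1) (-w) 1 (by omega) (by linarith) (by linarith)
        (by linarith) (by linarith)
      omega

theorem nec_pos (m p1 k : ℤ) (hp : 2 ≤ m) (hk : m - 1 ≤ 2 * k) (hk' : k ≤ m - 1)
    (H : ∀ u v, Good m p1 k m u v) : -m + k ≤ p1 ∧ p1 ≤ k + 1 := by
  have hm : m = |m| := (abs_of_nonneg (by omega)).symm
  constructor
  · by_contra c
    push Not at c
    by_cases c1 : p1 ≤ -m - k - 2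
    · refine good_not m p1 k m (fun u v => 0 ≤ u ∧ u ≤ v ∧ 1 ≤ v) (by simp) ?_ 0 1 (H 0 1) (by simp)
      rintro u v w ⟨a, b, d⟩ e f
      have : v < w + 1 := by
        by_contra h
        push Not at h
        nlinarith
      omega
    · by_cases c2 : -k ≤ 1 + p1 + m ∧ 1 + p1 + m < m - k
      · exact bad_one m p1 k m hm hp (-1) (by simp) (by linarith) (by linarith) (H _ _)
      · exact bad_one m p1 k m hm hp 1 (by simp) (by omega) (by omega) (H _ _)
  · by_contra c
    push Not at c
    by_cases c1 : p1 ≤ m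
    · exact bad_alt m p1 k m hm hp (by omega) (by omega) (by omega) (by omega) (H _ _)
    · push Not at c1
      refine good_not m p1 k m (fun u v => (0 ≤ -u ∧ -u ≤ v ∧ 1 ≤ v) ∨ (0 ≤ u ∧ u ≤ -v ∧ v ≤ -1))
        (by simp) ?_ 0 1 (H 0 1) (by simp)
      rintro u v w (⟨a, b, d⟩ | ⟨a, b, d⟩) e f
      · have : w ≤ -v := by
          by_contra h
          push Not at h
          nlinarith
        omega
      · have : -v < w + 1 := by
          by_contra h
          push Not at h
          nlinarith
        omega

theorem nec_neg (m p1 k : ℤ) (hp : 2 ≤ m) (hk : m - 1 ≤ 2 * k) (hk' : k ≤ m - 1)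
    (H : ∀ u v, Good (-m) p1 k m u v) : -k + 1 ≤ p1 ∧ p1 ≤ -k - 2 + m := by
  have hm : m = |-m| := by rw [abs_neg]; exact (abs_of_nonneg (by omega)).symm
  constructor
  · by_contra c
    push Not at c
    by_cases c1 : -m < p1
    · exact bad_alt (-m) p1 k m hm hp (by omega) (by omega) (by omega) (by omega) (H _ _)
    · push Not at c1
      refine good_not (-m) p1 k m
        (fun u v => (0 ≤ -u ∧ 1 ≤ v) ∨ (0 ≤ u ∧ v ≤ -1))
        (by simp) ?_ 0 1 (H 0 1) (by simp)
      rintro u v w (⟨a, d⟩ | ⟨a, d⟩) e f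
      · have : w ≤ -v := by
          by_contra h
          push Not at h
          nlinarith
        omega
      · have : -v < w + 1 := by
          by_contra h
          push Not at h
          nlinarith
        omega
  · by_contra c
    push Not at c
    by_cases c1 : m + k ≤ p1
    · refine good_not (-m) p1 k m (fun u v => 0 ≤ u ∧ 1 ≤ v) (by simp) ?_ 0 1 (H 0 1) (by simp)
      rintro u v w ⟨a, d⟩ e f
      have : v < w + 1 := by
        by_contra h
        push Not at h
        nlinarith
      omega
    · by_cases c2 : -k ≤ 1 + p1 - m ∧ 1 + p1 - m < m - k
      · exact bad_one (-m) p1 k m hm hp (-1) (by simp) (by linarith) (by linarith) (H _ _)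
      · exact bad_one (-m) p1 k m hm hp 1 (by simp) (by omega) (by omega) (H _ _)

/-- existence of a digit expansion -/
def HasRep (p0 p1 k m : ℤ) (l : ℕ) (a : Polynomial ℤ) : Prop :=
  ∃ dig : ℕ → ℤ, (∀ j < l, -k ≤ dig j ∧ dig j < m - k) ∧
    (X ^ 2 + C p1 * X + C p0 : Polynomial ℤ) ∣ a - ∑ j ∈ Finset.range l, C (dig j) * X ^ j

theorem good_rep (p0 p1 k m : ℤ) (hk : 0 ≤ k) (hk' : k < m) (u v : ℤ) (h : Good p0 p1 k m u v) :
    ∃ l, 0 < l ∧ HasRep p0 p1 k m l (C (-u - p1 * v) + C (-v) * X) := by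
  induction h with
  | zero => exact ⟨1, one_pos, fun _ => 0, fun j _ => ⟨by simpa using hk, by simpa using hk'⟩, by simp⟩
  | step u v w h1 h2 h ih =>
    obtain ⟨l, hl, dig, hd, Q, hQ⟩ := ih
    refine ⟨l + 1, by omega, fun j => Nat.casesOn j (-u - p1 * v - p0 * w) dig, ?_, X * Q - C w * (-1), ?_⟩
    · rintro (_ | j) hj
      · show -k ≤ -u - p1 * v - p0 * w ∧ -u - p1 * v - p0 * w < m - k
        constructor <;> linarith
      · exact hd j (by omega)
    · rw [Finset.sum_range_succ']
      have e : ∑ j ∈ Finset.range l, C (dig j) * (X : ℤ[X]) ^ (j + 1)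
          = X * ∑ j ∈ Finset.range l, C (dig j) * X ^ j := by
        rw [Finset.mul_sum]; refine Finset.sum_congr rfl fun j _ => by ring
      simp only [e]
      have e2 : ∑ j ∈ Finset.range l, C (dig j) * (X : ℤ[X]) ^ j =
        (C (-v - p1 * w) + C (-w) * X) - (X ^ 2 + C p1 * X + C p0) * Q := by rw [← hQ]; ring
      rw [e2]
      change C (-u - p1 * v) + C (-v) * X - (X * _ + C (-u - p1 * v - p0 * w) * X ^ 0) = _
      simp only [C_sub, C_neg, C_mul]
      ring

theorem rep_good (p0 p1 k m : ℤ) (hm : m = |p0|) (hp : 2 ≤ m) (l : ℕ) : ∀ (u v : ℤ),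
    HasRep p0 p1 k m l (C (-u - p1 * v) + C (-v) * X) → Good p0 p1 k m u v := by
  have hp0 : p0 ≠ 0 := by
    rintro rfl
    simp at hm
    omega
  induction l with
  | zero =>
    rintro u v ⟨dig, hd, h⟩
    have hdeg : (X ^ 2 + C p1 * X + C p0 : ℤ[X]).natDegree = 2 := by compute_degree!
    have : (C (-u - p1 * v) + C (-v) * X : ℤ[X]) = 0 := by
      refine eq_zero_of_dvd_of_natDegree_lt (p := X ^ 2 + C p1 * X + C p0)
        (by simpa only [Finset.range_zero, Finset.sum_empty, sub_zero] using h) ?_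
      rw [hdeg]
      have : (C (-u - p1 * v) + C (-v) * X : ℤ[X]).natDegree ≤ 1 := by compute_degree
      omega
    have c0 := congrArg (fun f => coeff f 0) this
    have c1 := congrArg (fun f => coeff f 1) this
    simp only [coeff_add, coeff_C_mul, coeff_X_one, coeff_X_zero, coeff_C_zero, coeff_zero,
      coeff_C_succ, mul_one, mul_zero, zero_add, add_zero, neg_eq_zero] at c0 c1
    subst c1
    simp at c0
    subst c0
    exact Good.zero
  | succ l ih =>
    rintro u v ⟨dig, hd, Q, hQ⟩
    rw [Finset.sum_range_succ'] at hQ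
    have e : ∑ j ∈ Finset.range l, C (dig (j+1)) * (X : ℤ[X]) ^ (j + 1)
        = X * ∑ j ∈ Finset.range l, C (dig (j+1)) * X ^ j := by
      rw [Finset.mul_sum]; refine Finset.sum_congr rfl fun j _ => by ring
    rw [e] at hQ
    have c0 := congrArg (fun f => eval 0 f) hQ
    simp at c0
    obtain ⟨w, hw⟩ : ∃ w, eval 0 Q = w := ⟨_, rfl⟩
    rw [hw] at c0
    obtain ⟨R, hR⟩ : X ∣ Q - C w := by
      rw [X_dvd_iff, coeff_zero_eq_eval_zero]; simp [hw]
    have hd0 := hd 0 (by omega)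
    refine Good.step u v w (by linarith) (by linarith) (ih v w ⟨fun j => dig (j+1), fun j hj => hd (j+1) (by omega), R, ?_⟩)
    apply mul_left_cancel₀ (X_ne_zero (R := ℤ))
    have hQ' : Q = X * R + C w := by rw [← hR]; ring
    rw [hQ'] at hQ
    have hd00 : dig 0 = -u - p1 * v - p0 * w := by linarith
    rw [hd00] at hQ
    simp only [C_sub, C_neg, C_mul] at hQ ⊢
    linear_combination hQ

theorem cns_iff (p0 p1 : ℤ) (hp : 2 ≤ |p0|) (ε : ℝ)
    (k : ℤ) (hk : k = ⌊ε * (|p0| : ℝ)⌋) (hk0 : 0 ≤ k) (hk1 : k < |p0|) :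
    IsEpsCNS ε (X ^ 2 + C p1 * X + C p0) ↔ ∀ u v, Good p0 p1 k |p0| u v := by
  have hcoef : (X ^ 2 + C p1 * X + C p0 : ℤ[X]).coeff 0 = p0 := by simp
  have hdig : ∀ d : ℤ, (-(ε * |(p0 : ℝ)|) ≤ (d : ℝ) ∧ (d : ℝ) < (1 - ε) * |(p0 : ℝ)|) ↔
      (-k ≤ d ∧ d < |p0| - k) := by
    intro d
    have a : -k ≤ d ↔ -d ≤ k := by omega
    have b : d < |p0| - k ↔ k < |p0| - d := by omega
    rw [a, b, hk, Int.le_floor, Int.floor_lt]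
    push_cast
    constructor <;> rintro ⟨h1, h2⟩ <;> constructor <;> linarith
  have key : IsEpsCNS ε (X ^ 2 + C p1 * X + C p0) ↔
      ∀ a, ∃ l, 0 < l ∧ HasRep p0 p1 k |p0| l a := by
    unfold IsEpsCNS HasRep
    simp only [hcoef, hdig]
  rw [key]
  constructor
  · intro H u v
    obtain ⟨l, -, h⟩ := H (C (-u - p1 * v) + C (-v) * X)
    exact rep_good p0 p1 k _ rfl hp l u v h
  · intro H a
    have hmon : (X ^ 2 + C p1 * X + C p0 : ℤ[X]).Monic := by monicity!
    have hdeg : (X ^ 2 + C p1 * X + C p0 : ℤ[X]).natDegree = 2 := by compute_degree!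
    have hlt := natDegree_modByMonic_lt a hmon (by intro h; rw [h] at hdeg; simp at hdeg)
    have hle : (a %ₘ (X ^ 2 + C p1 * X + C p0)).natDegree ≤ 1 := by omega
    obtain ⟨b, c, hbc⟩ := exists_eq_X_add_C_of_natDegree_le_one hle
    obtain ⟨l, hl, dig, hd, h⟩ := good_rep p0 p1 k _ hk0 hk1 (-c + p1 * b) (-b) (H _ _)
    refine ⟨l, hl, dig, hd, ?_⟩
    have e : a = (C b * X + C c) + (X ^ 2 + C p1 * X + C p0) * (a /ₘ (X ^ 2 + C p1 * X + C p0)) := by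
      rw [← hbc]; exact (modByMonic_add_div a _).symm
    have e2 : (C (-(-c + p1 * b) - p1 * (-b)) + C (-(-b)) * X : ℤ[X]) = C b * X + C c := by
      rw [show (-(-c + p1 * b) - p1 * (-b)) = c by ring, neg_neg]; ring
    rw [e2] at h
    rw [e, add_sub_right_comm]
    exact dvd_add h (Dvd.intro _ rfl)

/-- all digits nonpositive and a positive root: not a number system -/
theorem bad_top (m p1 : ℤ) (hp : 2 ≤ m) (l : ℕ) : ¬ HasRep (-m) p1 (m - 1) m l 1 := by
  rintro ⟨dig, hd, Q, hQ⟩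
  have hm : (2 : ℝ) ≤ m := by exact_mod_cast hp
  obtain ⟨β, hβ, hr⟩ : ∃ β : ℝ, 0 ≤ β ∧ β ^ 2 + p1 * β - m = 0 := by
    have hs := Real.sq_sqrt (show (0:ℝ) ≤ p1 ^ 2 + 4 * m by positivity)
    refine ⟨(-p1 + Real.sqrt (p1 ^ 2 + 4 * m)) / 2, ?_, ?_⟩
    · have : (p1 : ℝ) ≤ Real.sqrt (p1 ^ 2 + 4 * m) := Real.le_sqrt_of_sq_le (by linarith)
      linarith
    · linear_combination hs / 4
  have c := congrArg (fun f => aeval β f) hQ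
  simp only [map_sub, map_sum, map_mul, map_add, map_pow, aeval_X, aeval_C, map_one] at c
  have hz : β ^ 2 + (algebraMap ℤ ℝ) p1 * β + (algebraMap ℤ ℝ) (-m) = 0 := by
    rw [← hr]; simp; ring
  rw [hz, zero_mul] at c
  have : ∑ j ∈ Finset.range l, (algebraMap ℤ ℝ) (dig j) * β ^ j ≤ 0 := by
    refine Finset.sum_nonpos fun j hj => ?_
    have h1 := (hd j (Finset.mem_range.mp hj)).2
    have h2 : dig j ≤ 0 := by omega
    have h3 : ((dig j : ℤ) : ℝ) ≤ 0 := by exact_mod_cast h2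
    exact mul_nonpos_of_nonpos_of_nonneg (by simpa using h3) (by positivity)
  linarith

theorem stmt_4 (p0 p1 : ℤ) (hp : 2 ≤ |p0|) (ε : ℝ) (hε0 : 0 ≤ ε) (hε1 : ε < 1)
    (hcase : 1/2 < ε ∨ (ε = 1/2 ∧ Even |p0|))
    (k : ℤ) (hk : k = ⌊ε * (|p0| : ℝ)⌋) :
    IsEpsCNS ε (X ^ 2 + C p1 * X + C p0) ↔
      (2 ≤ p0 ∧ -|p0| + k ≤ p1 ∧ p1 ≤ k + 1) ∨
      (p0 ≤ -3 ∧ ε < ((|p0| : ℝ) - 1) / (|p0| : ℝ) ∧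
        -k + 1 ≤ p1 ∧ p1 ≤ -k - 2 + |p0|) := by
  have hmR : (2 : ℝ) ≤ |(p0 : ℝ)| := by exact_mod_cast hp
  have hk0 : 0 ≤ k := by rw [hk]; exact Int.floor_nonneg.mpr (by positivity)
  have hk1 : k < |p0| := by
    rw [hk, Int.floor_lt]; push_cast; nlinarith
  have hk2 : |p0| - 1 ≤ 2 * k := by
    have h1 : |p0| / 2 ≤ k := by
      rw [hk, Int.le_floor]
      have : 2 * (|p0| / 2) ≤ |p0| := by omega
      have h2 : (2 : ℝ) * ((|p0| / 2 : ℤ) : ℝ) ≤ |(p0 : ℝ)| := by exact_mod_cast this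
      have h3 : 1 / 2 ≤ ε := by rcases hcase with h | ⟨h, -⟩ <;> linarith
      nlinarith
    omega
  have hk3 : ε < ((|p0| : ℝ) - 1) / (|p0| : ℝ) ↔ k ≤ |p0| - 2 := by
    rw [lt_div_iff₀ (by linarith)]
    have : k ≤ |p0| - 2 ↔ k < |p0| - 1 := by omega
    rw [this, hk, Int.floor_lt]
    push_cast
    rfl
  rw [cns_iff p0 p1 hp ε k hk hk0 hk1, hk3]
  rcases le_or_gt 0 p0 with h | h
  · rw [abs_of_nonneg h] at *
    constructor
    · intro H
      exact Or.inl ⟨hp, nec_pos p0 p1 k hp hk2 (by omega) H⟩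
    · rintro (⟨a, b, c⟩ | ⟨a, b, c⟩)
      · exact good_pos p0 p1 k hp hk2 (by omega) b c
      · omega
  · rw [abs_of_neg h] at *
    obtain ⟨m, rfl⟩ : ∃ m, p0 = -m := ⟨-p0, by ring⟩
    rw [neg_neg] at *
    constructor
    · intro H
      have N := nec_neg m p1 k hp hk2 (by omega) H
      refine Or.inr ⟨by omega, ?_, N⟩
      by_contra c
      obtain rfl : k = m - 1 := by omega
      obtain ⟨l, -, hl⟩ := good_rep _ _ _ _ hk0 hk1 (-1) 0 (H (-1) 0)
      exact bad_top m p1 hp l (by simpa using hl)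
    · rintro (⟨a, b, c⟩ | ⟨a, b, c, d⟩)
      · omega
      · exact good_neg m p1 k hp hk2 b c d
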